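/- arXiv:1403.7776 — 2 statements merged into one kernel-verified Lean document; each statement's English description precedes it below -/
import Mathlib

section
/- Let ε be a splitting on an open set U ⊆ ℝⁿ whose algebroid curvature 𝔯 vanishes identically on U. Then the torsion bracket satisfies the Jacobi identity: for all x ∈ U and all u,v,w ∈ ℝⁿ, writing T(u,v)^i = T^i_{ab}(x)u^a v^b, one has T(u,T(v,w)) + T(v,T(w,u)) + T(w,T(u,v)) = 0. -/
noncomputable section

open Set

/-- The `j`-th coordinate partial derivative of a real-valued function on `ℝⁿ`. -/
noncomputable def pd {n : ℕ} (j : Fin n) (f : (Fin n → ℝ) → ℝ) (x : Fin n → ℝ) : ℝ :=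
  fderiv ℝ f x (Pi.single j 1)

/-- A splitting `ε` on `U`: a smooth groupoid homomorphism `U × U → GL(n,ℝ)`
satisfying `ε(z,y)ε(x,z) = ε(x,y)` and `ε(x,x) = id`. -/
structure IsSplitting {n : ℕ} (U : Set (Fin n → ℝ))
    (eps : (Fin n → ℝ) → (Fin n → ℝ) → Fin n → Fin n → ℝ) : Prop where
  smooth : ∀ i j : Fin n, ContDiffOn ℝ (⊤ : ℕ∞)
    (fun p : (Fin n → ℝ) × (Fin n → ℝ) => eps p.1 p.2 i j) (U ×ˢ U)
  comp : ∀ x ∈ U, ∀ y ∈ U, ∀ z ∈ U, ∀ i j : Fin n,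
    (∑ a, eps z y i a * eps x z a j) = eps x y i j
  refl : ∀ x ∈ U, ∀ i j : Fin n, eps x x i j = if i = j then (1 : ℝ) else 0

/-- `Γ^i_{jk}(x) = (∂ε^i_k(x,y)/∂y^j)|_{y=x}`. -/
noncomputable def Gam {n : ℕ} (eps : (Fin n → ℝ) → (Fin n → ℝ) → Fin n → Fin n → ℝ)
    (i j k : Fin n) (x : Fin n → ℝ) : ℝ :=
  pd j (fun y => eps x y i k) x

/-- The groupoid curvature `R^i_{jk}(x,y)`. -/
noncomputable def Rg {n : ℕ} (eps : (Fin n → ℝ) → (Fin n → ℝ) → Fin n → Fin n → ℝ)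
    (i j k : Fin n) (x y : Fin n → ℝ) : ℝ :=
  pd j (fun x' => eps x' y i k) x + ∑ a, pd a (fun y' => eps x y' i k) y * eps x y a j
    - pd k (fun x' => eps x' y i j) x - ∑ a, pd a (fun y' => eps x y' i j) y * eps x y a k

/-- The algebroid curvature `𝔯^i_{jk,r}(x)`. -/
noncomputable def ra {n : ℕ} (eps : (Fin n → ℝ) → (Fin n → ℝ) → Fin n → Fin n → ℝ)
    (i j k r : Fin n) (x : Fin n → ℝ) : ℝ :=
  pd j (Gam eps i r k) x + ∑ a, Gam eps a r j x * Gam eps i a k x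
    - pd k (Gam eps i r j) x - ∑ a, Gam eps a r k x * Gam eps i a j x

/-- The torsion `T^i_{jk} = Γ^i_{jk} − Γ^i_{kj}`. -/
noncomputable def Tor {n : ℕ} (eps : (Fin n → ℝ) → (Fin n → ℝ) → Fin n → Fin n → ℝ)
    (i j k : Fin n) (x : Fin n → ℝ) : ℝ :=
  Gam eps i j k x - Gam eps i k j x

/-- A vector field `ξ` is `ε`-parallel if `ξ^i(y) = ε^i_a(x,y) ξ^a(x)` for all `x, y ∈ U`. -/
def EpsParallelVF {n : ℕ} (U : Set (Fin n → ℝ))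
    (eps : (Fin n → ℝ) → (Fin n → ℝ) → Fin n → Fin n → ℝ)
    (ξ : (Fin n → ℝ) → Fin n → ℝ) : Prop :=
  ∀ x ∈ U, ∀ y ∈ U, ∀ i, ξ y i = ∑ a, eps x y i a * ξ x a

/-- The torsion bracket `T(u,v)^i = T^i_{ab} u^a v^b`. -/
noncomputable def torBr {n : ℕ} (eps : (Fin n → ℝ) → (Fin n → ℝ) → Fin n → Fin n → ℝ)
    (x : Fin n → ℝ) (u v : Fin n → ℝ) (i : Fin n) : ℝ :=
  ∑ a, ∑ b, Tor eps i a b x * u a * v b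

theorem pd_congr {n : ℕ} {f g : (Fin n → ℝ) → ℝ} {x : Fin n → ℝ} (j : Fin n)
    (h : f =ᶠ[nhds x] g) : pd j f x = pd j g x := by
  simp only [pd, h.fderiv_eq]

theorem pd_sum {n : ℕ} {f : Fin n → (Fin n → ℝ) → ℝ} {x : Fin n → ℝ} (j : Fin n)
    (hf : ∀ a, DifferentiableAt ℝ (f a) x) :
    pd j (fun y => ∑ a, f a y) x = ∑ a, pd j (f a) x := by
  simp only [pd]
  rw [fderiv_fun_sum fun a _ => hf a]
  simp

theorem pd_mul {n : ℕ} {f g : (Fin n → ℝ) → ℝ} {x : Fin n → ℝ} (j : Fin n)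
    (hf : DifferentiableAt ℝ f x) (hg : DifferentiableAt ℝ g x) :
    pd j (fun y => f y * g y) x = f x * pd j g x + pd j f x * g x := by
  simp only [pd]
  rw [fderiv_fun_mul hf hg]
  simp [mul_comm]

theorem pd_mul_const {n : ℕ} {f : (Fin n → ℝ) → ℝ} {x : Fin n → ℝ} (j : Fin n)
    (hf : DifferentiableAt ℝ f x) (c : ℝ) :
    pd j (fun y => f y * c) x = pd j f x * c := by
  rw [pd_mul j hf (differentiableAt_const c)]
  simp [pd]

theorem ContDiffAt.differentiableAt_pd {n : ℕ} {f : (Fin n → ℝ) → ℝ} {x : Fin n → ℝ}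
    (hf : ContDiffAt ℝ 2 f x) (j : Fin n) : DifferentiableAt ℝ (pd j f) x :=
  ((hf.fderiv_right (m := 1) (by norm_num)).differentiableAt (by norm_num)).clm_apply
    (differentiableAt_const _)

/-- Coordinate partial derivatives of a `C²` function commute. -/
theorem pd_comm {n : ℕ} {f : (Fin n → ℝ) → ℝ} {x : Fin n → ℝ}
    (hf : ContDiffAt ℝ 2 f x) (j k : Fin n) : pd j (pd k f) x = pd k (pd j f) x := by
  have hd : DifferentiableAt ℝ (fderiv ℝ f) x :=
    (hf.fderiv_right (m := 1) (by norm_num)).differentiableAt (by norm_num)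
  have key : ∀ a b : Fin n,
      pd a (pd b f) x = fderiv ℝ (fderiv ℝ f) x (Pi.single a 1) (Pi.single b 1) := by
    intro a b
    change fderiv ℝ (fun y => fderiv ℝ f y (Pi.single b 1)) x (Pi.single a 1) = _
    rw [fderiv_clm_apply hd (differentiableAt_const _)]
    simp
  rw [key, key]
  exact (hf.isSymmSndFDerivAt (by simp)).eq _ _

namespace IsSplitting

variable {n : ℕ} {U : Set (Fin n → ℝ)}
  {eps : (Fin n → ℝ) → (Fin n → ℝ) → Fin n → Fin n → ℝ}

theorem contDiffAt_right (heps : IsSplitting U eps) (hU : IsOpen U) {x y : Fin n → ℝ}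
    (hx : x ∈ U) (hy : y ∈ U) (i k : Fin n) :
    ContDiffAt ℝ (⊤ : ℕ∞) (fun z => eps x z i k) y :=
  ((heps.smooth i k).contDiffAt ((hU.prod hU).mem_nhds ⟨hx, hy⟩)).comp
    y (contDiffAt_const.prodMk contDiffAt_id)

theorem contDiffAt_left (heps : IsSplitting U eps) (hU : IsOpen U) {x y : Fin n → ℝ}
    (hx : x ∈ U) (hy : y ∈ U) (i k : Fin n) :
    ContDiffAt ℝ (⊤ : ℕ∞) (fun z => eps z y i k) x :=
  ((heps.smooth i k).contDiffAt ((hU.prod hU).mem_nhds ⟨hx, hy⟩)).comp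
    x (contDiffAt_id.prodMk contDiffAt_const)

theorem pd_right (heps : IsSplitting U eps) (hU : IsOpen U) {x y z : Fin n → ℝ}
    (hx : x ∈ U) (hy : y ∈ U) (hz : z ∈ U) (i r k : Fin n) :
    pd r (fun y' => eps x y' i k) y = ∑ a, pd r (fun y' => eps z y' i a) y * eps x z a k := by
  have hd : ∀ a, DifferentiableAt ℝ (fun y' => eps z y' i a) y := fun a =>
    (heps.contDiffAt_right hU hz hy i a).differentiableAt (by simp)
  have h : (fun y' => eps x y' i k) =ᶠ[nhds y] fun y' => ∑ a, eps z y' i a * eps x z a k := by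
    filter_upwards [hU.mem_nhds hy] with y' hy'
    exact (heps.comp x hx y' hy' z hz i k).symm
  rw [pd_congr r h, pd_sum r fun a => (hd a).mul_const _]
  exact Finset.sum_congr rfl fun a _ => pd_mul_const r (hd a) _

theorem differentiableAt_gam (heps : IsSplitting U eps) (hU : IsOpen U) {x : Fin n → ℝ}
    (hx : x ∈ U) (i r k : Fin n) : DifferentiableAt ℝ (Gam eps i r k) x := by
  have h : Gam eps i r k =ᶠ[nhds x]
      fun y => ∑ a, pd r (fun y' => eps x y' i a) y * eps y x a k := by
    filter_upwards [hU.mem_nhds hx] with y hy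
    exact heps.pd_right hU hy hy hx i r k
  refine DifferentiableAt.congr_of_eventuallyEq (.fun_sum fun a _ => ?_) h
  exact (ContDiffAt.differentiableAt_pd
    ((heps.contDiffAt_right hU hx hx i a).of_le ENat.LEInfty.out) r).mul
    ((heps.contDiffAt_left hU hx hx a k).differentiableAt (by simp))

theorem pd_pd_right (heps : IsSplitting U eps) (hU : IsOpen U) {x : Fin n → ℝ}
    (hx : x ∈ U) (i j r k : Fin n) :
    pd j (pd r fun y => eps x y i k) x =
      pd j (Gam eps i r k) x + ∑ a, Gam eps i r a x * Gam eps a j k x := by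
  have h : (pd r fun y => eps x y i k) =ᶠ[nhds x]
      fun y => ∑ a, Gam eps i r a y * eps x y a k := by
    filter_upwards [hU.mem_nhds hx] with y hy
    exact heps.pd_right hU hx hy hy i r k
  have hG := fun a => heps.differentiableAt_gam hU hx i r a
  have hE := fun a => (heps.contDiffAt_right hU hx hx a k).differentiableAt (by simp)
  rw [pd_congr j h, pd_sum j fun a => (hG a).fun_mul (hE a),
    Finset.sum_congr rfl fun a _ => pd_mul j (hG a) (hE a), Finset.sum_add_distrib, add_comm]
  simp [heps.refl x hx, Gam]

/-- The linear connection defined by a splitting is flat. -/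
theorem pd_gam_sub (heps : IsSplitting U eps) (hU : IsOpen U) {x : Fin n → ℝ}
    (hx : x ∈ U) (i j r k : Fin n) :
    pd j (Gam eps i r k) x - pd r (Gam eps i j k) x =
      ∑ a, Gam eps i j a x * Gam eps a r k x - ∑ a, Gam eps i r a x * Gam eps a j k x := by
  have h := pd_comm (x := x)
    ((heps.contDiffAt_right hU hx hx i k).of_le ENat.LEInfty.out) j r
  rw [heps.pd_pd_right hU hx, heps.pd_pd_right hU hx] at h
  linarith

theorem tor_jacobi (heps : IsSplitting U eps) (hU : IsOpen U) {x : Fin n → ℝ} (hx : x ∈ U)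
    (hflat : ∀ i j k r : Fin n, ra eps i j k r x = 0) (i j k r : Fin n) :
    ∑ a, Tor eps i j a x * Tor eps a k r x + ∑ a, Tor eps i k a x * Tor eps a r j x
      + ∑ a, Tor eps i r a x * Tor eps a j k x = 0 := by
  have b₁ := heps.pd_gam_sub hU hx i j k r
  have b₂ := heps.pd_gam_sub hU hx i k r j
  have b₃ := heps.pd_gam_sub hU hx i r j k
  have c₁ := hflat i j k r
  have c₂ := hflat i k r j
  have c₃ := hflat i r j k
  simp only [ra, mul_comm (Gam eps _ _ _ x) (Gam eps i _ _ x)] at c₁ c₂ c₃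
  simp only [Tor, sub_mul, mul_sub, Finset.sum_sub_distrib]
  linarith

end IsSplitting

theorem torBr_torBr {n : ℕ} (eps : (Fin n → ℝ) → (Fin n → ℝ) → Fin n → Fin n → ℝ)
    (x u v w : Fin n → ℝ) (i : Fin n) :
    torBr eps x u (torBr eps x v w) i =
      ∑ a, ∑ b, ∑ c, (∑ d, Tor eps i a d x * Tor eps d b c x) * (u a * v b * w c) := by
  simp only [torBr, Finset.mul_sum, Finset.sum_mul]
  refine Finset.sum_congr rfl fun a _ => ?_
  rw [Finset.sum_comm]
  refine Finset.sum_congr rfl fun b _ => ?_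
  rw [Finset.sum_comm]
  exact Finset.sum_congr rfl fun c _ => Finset.sum_congr rfl fun d _ => by ring

/-- If `𝔯 ≡ 0` on `U`, then the torsion bracket satisfies the Jacobi
identity: `T(u,T(v,w)) + T(v,T(w,u)) + T(w,T(u,v)) = 0`. -/
theorem stmt_11 {n : ℕ} (hn : 2 ≤ n) (U : Set (Fin n → ℝ)) (hU : IsOpen U)
    (eps : (Fin n → ℝ) → (Fin n → ℝ) → Fin n → Fin n → ℝ) (heps : IsSplitting U eps)
    (hflat : ∀ x ∈ U, ∀ i j k r : Fin n, ra eps i j k r x = 0) :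
    ∀ x ∈ U, ∀ u v w : Fin n → ℝ, ∀ i : Fin n,
      torBr eps x u (torBr eps x v w) i + torBr eps x v (torBr eps x w u) i
        + torBr eps x w (torBr eps x u v) i = 0 := by
  intro x hx u v w i
  have rot : ∀ f : Fin n → Fin n → Fin n → ℝ,
      ∑ a, ∑ b, ∑ c, f a b c = ∑ a, ∑ b, ∑ c, f b c a := by
    intro f
    symm
    rw [Finset.sum_comm]
    exact Finset.sum_congr rfl fun b _ => Finset.sum_comm
  rw [torBr_torBr, torBr_torBr eps x v w u, torBr_torBr eps x w u v,
    rot fun a b c => _ * (v a * w b * u c), rot fun a b c => _ * (w a * u b * v c),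
    rot fun a b c => _ * (w b * u c * v a)]
  simp only [← Finset.sum_add_distrib]
  refine Finset.sum_eq_zero fun a _ => Finset.sum_eq_zero fun b _ =>
    Finset.sum_eq_zero fun c _ => ?_
  linear_combination (u a * v b * w c) * heps.tor_jacobi hU hx (hflat x hx) i a b c
end
end

section
/- Let ε be a splitting on an open set U ⊆ ℝⁿ, fix a basepoint p ∈ U, and let g be the canonical metric. Define the Christoffel symbols of g by Σ^i_{jk} = (1/2) g^{ia} (∂g_{ak}/∂x^j + ∂g_{aj}/∂x^k − ∂g_{jk}/∂x^a). Then for all x ∈ U and all indices, Σ^i_{jk} = −(1/2) ( Γ^i_{jk} + Γ^i_{kj} + T^a_{jb} g_{ka} g^{ib} + T^a_{kb} g_{ja} g^{ib} ). -/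
noncomputable section

open Set

/-- The canonical metric `g_{ij}(x) = Σ_a ε^a_i(x,p) ε^a_j(x,p)` of `(M,ε)` with
basepoint `p`. -/
noncomputable def canG {n : ℕ} (eps : (Fin n → ℝ) → (Fin n → ℝ) → Fin n → Fin n → ℝ)
    (p : Fin n → ℝ) (i j : Fin n) (x : Fin n → ℝ) : ℝ :=
  ∑ a, eps x p a i * eps x p a j

/-- The inverse `g^{ij}` of the canonical metric. -/
noncomputable def canGinv {n : ℕ} (eps : (Fin n → ℝ) → (Fin n → ℝ) → Fin n → Fin n → ℝ)
    (p : Fin n → ℝ) (i j : Fin n) (x : Fin n → ℝ) : ℝ :=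
  (Matrix.of fun a b => canG eps p a b x)⁻¹ i j

lemma pd_sum_mul {n : ℕ} {f g : Fin n → (Fin n → ℝ) → ℝ} {x : Fin n → ℝ}
    (hf : ∀ a, DifferentiableAt ℝ (f a) x) (hg : ∀ a, DifferentiableAt ℝ (g a) x) (j : Fin n) :
    pd j (fun z => ∑ a, f a z * g a z) x = ∑ a, (f a x * pd j (g a) x + g a x * pd j (f a) x) := by
  unfold pd
  rw [fderiv_fun_sum fun a _ => (hf a).fun_mul (hg a)]
  simp [fderiv_fun_mul (hf _) (hg _)]

namespace IsSplitting

variable {n : ℕ} {U : Set (Fin n → ℝ)}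
  {eps : (Fin n → ℝ) → (Fin n → ℝ) → Fin n → Fin n → ℝ}

lemma differentiableAt_uncurry (heps : IsSplitting U eps) (hU : IsOpen U)
    {x y : Fin n → ℝ} (hx : x ∈ U) (hy : y ∈ U) (i j : Fin n) :
    DifferentiableAt ℝ (fun q : (Fin n → ℝ) × (Fin n → ℝ) => eps q.1 q.2 i j) (x, y) :=
  ((heps.smooth i j).contDiffAt ((hU.prod hU).mem_nhds ⟨hx, hy⟩)).differentiableAt (by simp)

lemma differentiableAt_left (heps : IsSplitting U eps) (hU : IsOpen U)
    {x y : Fin n → ℝ} (hx : x ∈ U) (hy : y ∈ U) (i j : Fin n) :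
    DifferentiableAt ℝ (fun z => eps z y i j) x :=
  DifferentiableAt.comp (f := fun z => (z, y)) x
    (heps.differentiableAt_uncurry hU hx hy i j) (by fun_prop)

lemma differentiableAt_right (heps : IsSplitting U eps) (hU : IsOpen U)
    {x y : Fin n → ℝ} (hx : x ∈ U) (hy : y ∈ U) (i j : Fin n) :
    DifferentiableAt ℝ (fun z => eps x z i j) y :=
  DifferentiableAt.comp (f := fun z => (x, z)) y
    (heps.differentiableAt_uncurry hU hx hy i j) (by fun_prop)

/-- The derivative of a splitting in its first argument is governed by `Γ`. -/
lemma pd_left (heps : IsSplitting U eps) (hU : IsOpen U) {x p : Fin n → ℝ} (hx : x ∈ U)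
    (hp : p ∈ U) (j a k : Fin n) :
    pd j (fun z => eps z p a k) x = -∑ b, eps x p a b * Gam eps b j k x := by
  have hconst : (fun z => ∑ b, eps z p a b * eps x z b k) =ᶠ[nhds x] fun _ => eps x p a k := by
    filter_upwards [hU.mem_nhds hx] with z hz using heps.comp x hx p hp z hz a k
  have hzero : pd j (fun z => ∑ b, eps z p a b * eps x z b k) x = 0 := by
    simp [pd, hconst.fderiv_eq]
  rw [pd_sum_mul (fun b => heps.differentiableAt_left hU hx hp a b)
    (fun b => heps.differentiableAt_right hU hx hx b k)] at hzero
  simp only [heps.refl x hx, ite_mul, one_mul, zero_mul, Finset.sum_add_distrib,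
    Finset.sum_ite_eq', Finset.mem_univ, if_true] at hzero
  unfold Gam
  linarith

lemma pd_canG (heps : IsSplitting U eps) (hU : IsOpen U) {x p : Fin n → ℝ} (hx : x ∈ U)
    (hp : p ∈ U) (a j k : Fin n) :
    pd a (canG eps p j k) x =
      -∑ b, (canG eps p j b x * Gam eps b a k x + canG eps p k b x * Gam eps b a j x) := by
  have h := pd_sum_mul (fun c => heps.differentiableAt_left hU hx hp c j)
    (fun c => heps.differentiableAt_left hU hx hp c k) a
  change pd a (fun z => ∑ c, eps z p c j * eps z p c k) x = _
  rw [h]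
  simp only [heps.pd_left hU hx hp, canG, Finset.sum_mul, Finset.sum_add_distrib, mul_neg,
    Finset.mul_sum, Finset.sum_neg_distrib, neg_add]
  congr 2 <;> rw [Finset.sum_comm] <;> simp only [mul_assoc]

lemma sum_canGinv_mul_canG (heps : IsSplitting U eps) {x p : Fin n → ℝ} (hx : x ∈ U)
    (hp : p ∈ U) (i j : Fin n) :
    ∑ a, canGinv eps p i a x * canG eps p a j x = if i = j then 1 else 0 := by
  have hleft : Matrix.of (eps p x) * Matrix.of (eps x p) = 1 := by
    ext i j
    simp [Matrix.mul_apply, heps.comp x hx x hx p hp, heps.refl x hx, Matrix.one_apply]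
  have hE : IsUnit (Matrix.of (eps x p)).det := Matrix.isUnit_det_of_left_inverse hleft
  have hG : (Matrix.of fun a b => canG eps p a b x) =
      (Matrix.of (eps x p)).transpose * Matrix.of (eps x p) := by
    ext a b
    simp [Matrix.mul_apply, canG]
  have hdet : IsUnit (Matrix.of fun a b => canG eps p a b x).det := by
    rw [hG, Matrix.det_mul, Matrix.det_transpose]
    exact hE.mul hE
  have h := congrFun (congrFun (Matrix.nonsing_inv_mul _ hdet) i) j
  simpa only [Matrix.mul_apply, Matrix.one_apply, Matrix.of_apply, canGinv] using h

lemma sum_canGinv_mul_sum_canG (heps : IsSplitting U eps) {x p : Fin n → ℝ} (hx : x ∈ U)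
    (hp : p ∈ U) (i : Fin n) (v : Fin n → ℝ) :
    ∑ a, canGinv eps p i a x * ∑ b, canG eps p a b x * v b = v i := by
  simp only [Finset.mul_sum]
  rw [Finset.sum_comm]
  simp only [← mul_assoc, ← Finset.sum_mul, heps.sum_canGinv_mul_canG hx hp]
  simp

end IsSplitting

/-- The Christoffel symbols
`Σ^i_{jk} = (1/2) g^{ia}(∂g_{ak}/∂x^j + ∂g_{aj}/∂x^k − ∂g_{jk}/∂x^a)` of the canonical
metric satisfy `Σ^i_{jk} = −(1/2)(Γ^i_{jk} + Γ^i_{kj} + T^a_{jb}g_{ka}g^{ib} + T^a_{kb}g_{ja}g^{ib})`. -/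
theorem stmt_15 {n : ℕ} (hn : 2 ≤ n) (U : Set (Fin n → ℝ)) (hU : IsOpen U)
    (eps : (Fin n → ℝ) → (Fin n → ℝ) → Fin n → Fin n → ℝ) (heps : IsSplitting U eps)
    (p : Fin n → ℝ) (hp : p ∈ U) :
    ∀ x ∈ U, ∀ i j k : Fin n,
      (1 / 2 : ℝ) * ∑ a, canGinv eps p i a x *
          (pd j (canG eps p a k) x + pd k (canG eps p a j) x - pd a (canG eps p j k) x) =
        -(1 / 2 : ℝ) * (Gam eps i j k x + Gam eps i k j x
          + ∑ a, ∑ b, Tor eps a j b x * canG eps p k a x * canGinv eps p i b x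
          + ∑ a, ∑ b, Tor eps a k b x * canG eps p j a x * canGinv eps p i b x) := by
  intro x hx i j k
  have hjk := heps.sum_canGinv_mul_sum_canG hx hp i (fun b => Gam eps b j k x)
  have hkj := heps.sum_canGinv_mul_sum_canG hx hp i (fun b => Gam eps b k j x)
  have htor (l m : Fin n) :
      ∑ a, ∑ b, Tor eps a l b x * canG eps p m a x * canGinv eps p i b x =
        ∑ a, canGinv eps p i a x * ∑ b, canG eps p m b x * Tor eps b l a x := by
    rw [Finset.sum_comm]
    simp only [Finset.mul_sum]
    exact Finset.sum_congr rfl fun _ _ => Finset.sum_congr rfl fun _ _ => by ring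
  rw [htor, htor, ← hjk, ← hkj]
  simp only [heps.pd_canG hU hx hp, Tor, Finset.mul_sum, ← Finset.sum_add_distrib,
    ← Finset.sum_neg_distrib, ← Finset.sum_sub_distrib]
  exact Finset.sum_congr rfl fun _ _ => Finset.sum_congr rfl fun _ _ => by ring
end
end
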